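/- The only solutions in nonnegative integers of the simultaneous Pell equations y^2 - 3x^2 = 1 and z^2 - 6x^2 = 4 are (x, y, z) with x = 0 or x = 4 (i.e., (0, 1, 2) and (4, 7, 10)). -/

import Mathlib

theorem Int.exists_sq_of_isCoprime_of_pos {a b c : ℤ} (h : IsCoprime a b) (ha : 0 < a)
    (heq : a * b = c ^ 2) : ∃ r, a = r ^ 2 := by
  obtain ⟨r, hr | hr⟩ := Int.sq_of_isCoprime h heq
  · exact ⟨r, hr⟩
  · nlinarith [sq_nonneg r]

theorem isCoprime_sub_add {m n : ℤ} (h : IsCoprime m n) (hodd : (m - n) % 2 = 1) :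
    IsCoprime (m - n) (m + n) := by
  have h2 : IsCoprime (m - n) 2 := ⟨1, -((m - n) / 2), by omega⟩
  have hn : IsCoprime (m - n) n := by
    obtain ⟨u, v, huv⟩ := h
    exact ⟨u, u + v, by linear_combination huv⟩
  have := (h2.mul_right hn).add_mul_left_right 1
  rwa [show 2 * n + (m - n) * 1 = m + n by ring] at this

/-- The area of a primitive right triangle is a square only if it comes from coprime squares whose
sum and difference are both squares. -/
theorem exists_sq_add_sq_sub {m n e : ℤ} (hm : 0 < m) (hn : 0 < n) (hmn : IsCoprime m n)
    (hodd : (m - n) % 2 = 1) (he : e ≠ 0) (h : m * n * (m ^ 2 - n ^ 2) = e ^ 2) :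
    ∃ a b c d : ℤ, IsCoprime a b ∧ a ^ 2 + b ^ 2 = c ^ 2 ∧ a ^ 2 - b ^ 2 = d ^ 2 ∧
      b ≠ 0 ∧ b ^ 2 ≤ e ^ 2 := by
  have he2 : 0 < e ^ 2 := by positivity
  have hpos : 0 < m ^ 2 - n ^ 2 := pos_of_mul_pos_right (h ▸ he2) (by positivity)
  have hlt : 0 < m - n := by nlinarith
  have hcm : IsCoprime m (m ^ 2 - n ^ 2) := by
    have := ((hmn.pow_right (n := 2)).neg_right).add_mul_left_right m
    rwa [show -n ^ 2 + m * m = m ^ 2 - n ^ 2 by ring] at this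
  have hcn : IsCoprime n (m ^ 2 - n ^ 2) := by
    have := (hmn.symm.pow_right (n := 2)).add_mul_left_right (-n)
    rwa [show m ^ 2 + n * -n = m ^ 2 - n ^ 2 by ring] at this
  obtain ⟨a, ha⟩ := Int.exists_sq_of_isCoprime_of_pos (hmn.mul_right hcm) hm
    (c := e) (by linear_combination h)
  obtain ⟨b, hb⟩ := Int.exists_sq_of_isCoprime_of_pos (hmn.symm.mul_right hcn) hn
    (c := e) (by linear_combination h)
  obtain ⟨f, hf⟩ := Int.exists_sq_of_isCoprime_of_pos (hcm.mul_left hcn).symm hpos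
    (c := e) (by linear_combination h)
  have hc := isCoprime_sub_add hmn hodd
  obtain ⟨d, hd⟩ := Int.exists_sq_of_isCoprime_of_pos hc hlt
    (c := f) (by linear_combination hf)
  obtain ⟨c, hc⟩ := Int.exists_sq_of_isCoprime_of_pos hc.symm (by positivity)
    (c := f) (by linear_combination hf)
  refine ⟨a, b, c, d, ?_, by rw [← ha, ← hb, hc], by rw [← ha, ← hb, hd], ?_, ?_⟩
  · rw [ha, hb] at hmn
    exact (IsCoprime.pow_iff two_pos two_pos).1 hmn
  · rintro rfl
    simp [hb] at hn
  · rw [← hb, ← h]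
    have : 1 ≤ m * (m ^ 2 - n ^ 2) := by have := mul_pos hm hpos; omega
    nlinarith

/-- There are no coprime squares, the smaller one nonzero, whose sum and difference are both
squares. -/
theorem eq_zero_of_sq_add_sq_sub {a b c d : ℤ} (hab : IsCoprime a b)
    (hc : a ^ 2 + b ^ 2 = c ^ 2) (hd : a ^ 2 - b ^ 2 = d ^ 2) : b = 0 := by
  induction hk : b.natAbs using Nat.strong_induction_on generalizing a b c d with
  | _ k ih =>
  by_contra hb
  have hpar : (c + d) % 2 = 0 := by
    have : (c + d) * (c + d) = 2 * (b ^ 2 + d ^ 2 + c * d) := by linear_combination hd - hc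
    have : Even ((c + d) * (c + d)) := ⟨b ^ 2 + d ^ 2 + c * d, by linear_combination this⟩
    have : Even (c + d) := by simpa [Int.even_mul] using this
    exact Int.even_iff.1 this
  obtain ⟨p, hp⟩ : ∃ p, p = (c + d) / 2 := ⟨_, rfl⟩
  obtain ⟨q, rfl⟩ : ∃ q, c = p + q := ⟨c - p, by ring⟩
  obtain rfl : d = p - q := by omega
  have ha2 : a ^ 2 = p ^ 2 + q ^ 2 := by linarith
  have hb2 : b ^ 2 = 2 * p * q := by linarith
  have hpq : IsCoprime p q := by
    obtain ⟨u, v, huv⟩ := hab.pow (m := 2) (n := 2)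
    rw [ha2, hb2] at huv
    exact ⟨u * p, u * q + 2 * v * p, by linear_combination huv⟩
  obtain ⟨m, n, hmn, -, hcop, hparity⟩ := PythagoreanTriple.coprime_classification.1
    ⟨show PythagoreanTriple p q a by unfold PythagoreanTriple; linarith,
      Int.isCoprime_iff_gcd_eq_one.1 hpq⟩
  have hcop := Int.isCoprime_iff_gcd_eq_one.2 hcop
  have hodd : (m - n) % 2 = 1 := by omega
  have h4 : b ^ 2 = 4 * (m * n * (m ^ 2 - n ^ 2)) := by
    rcases hmn with ⟨rfl, rfl⟩ | ⟨rfl, rfl⟩ <;> rw [hb2] <;> ring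
  have hbe : Even b := by
    have : Even (b ^ 2) := ⟨2 * (m * n * (m ^ 2 - n ^ 2)), by rw [h4]; ring⟩
    exact (Int.even_pow.1 this).1
  obtain ⟨e, rfl⟩ := hbe
  have he : e ≠ 0 := by omega
  have h : m * n * (m ^ 2 - n ^ 2) = e ^ 2 := by linarith
  have he2 : 0 < e ^ 2 := by positivity
  obtain ⟨a', b', c', d', hab', hc', hd', hb', hle⟩ :
      ∃ a b c d : ℤ, IsCoprime a b ∧ a ^ 2 + b ^ 2 = c ^ 2 ∧ a ^ 2 - b ^ 2 = d ^ 2 ∧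
        b ≠ 0 ∧ b ^ 2 ≤ e ^ 2 := by
    have hm0 : m ≠ 0 := by rintro rfl; simp at h; omega
    have hn0 : n ≠ 0 := by rintro rfl; simp at h; omega
    rcases lt_or_gt_of_ne hm0 with hm | hm <;> rcases lt_or_gt_of_ne hn0 with hn | hn
    · exact exists_sq_add_sq_sub (neg_pos.2 hm) (neg_pos.2 hn) hcop.neg_neg (by omega) he
        (by linear_combination h)
    · exact exists_sq_add_sq_sub hn (neg_pos.2 hm) hcop.symm.neg_right (by omega) he
        (by linear_combination h)
    · exact exists_sq_add_sq_sub (neg_pos.2 hn) hm hcop.symm.neg_left (by omega) he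
        (by linear_combination h)
    · exact exists_sq_add_sq_sub hm hn hcop hodd he h
  have := sq_le_sq.1 hle
  rw [Int.abs_eq_natAbs, Int.abs_eq_natAbs] at this
  exact hb' (ih b'.natAbs (by omega) hab' hc' hd' rfl)

theorem sq_eq_one_of_pow_four_add_one {c d : ℤ} (h : c ^ 4 + 1 = 2 * d ^ 4) : c ^ 2 = 1 := by
  have hodd : Odd c := by
    have : Even (c ^ 4 + 1) := ⟨d ^ 4, by rw [h]; ring⟩
    rw [Int.even_add_one, Int.not_even_iff_odd] at this
    exact (Int.odd_pow' (by norm_num)).1 this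
  obtain ⟨A, hA⟩ : ∃ A, c ^ 2 = 2 * A + 1 := (hodd.pow (n := 2))
  have hd : d ^ 4 = (A + 1) ^ 2 + A ^ 2 := by
    have : c ^ 4 = (2 * A + 1) ^ 2 := by rw [← hA]; ring
    linarith
  have := eq_zero_of_sq_add_sq_sub (a := A + 1) (b := A) (c := d ^ 2) (d := c)
    ⟨1, -1, by ring⟩ (by rw [← hd]; ring) (by rw [hA]; ring)
  omega

/-- An odd term `p` of a solution of `X ^ 2 - 8 * p ^ 2 = 1` factors as `c * d` with
`c ^ 2 - 2 * d ^ 2 = -1`. -/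
theorem exists_mul_eq_of_sq_eq {X p : ℤ} (hp : 0 < p) (hodd : p % 2 = 1)
    (h : X ^ 2 = 8 * p ^ 2 + 1) :
    ∃ c d : ℤ, 0 < c ∧ 0 < d ∧ IsCoprime c d ∧ p = c * d ∧ c ^ 2 + 1 = 2 * d ^ 2 := by
  wlog hX : 0 ≤ X generalizing X
  · exact this (X := -X) (by linarith) (by omega)
  have hX1 : 1 < X := by nlinarith
  have hXo : Odd X := by
    have : Odd (X ^ 2) := ⟨4 * p ^ 2, by rw [h]; ring⟩
    exact (Int.odd_pow' (by norm_num)).1 this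
  obtain ⟨n, rfl⟩ := hXo
  have hn : n * (n + 1) = 2 * p ^ 2 := by linarith
  have hn0 : 0 < n := by omega
  have hp4 : p ^ 2 % 4 = 1 := by
    rcases (by omega : p % 4 = 1 ∨ p % 4 = 3) with h | h <;> simp [pow_two, Int.mul_emod, h]
  have key : ∀ a b : ℤ, 0 < a → 0 < b → IsCoprime a (2 * b) → a * b = p ^ 2 →
      ∃ c d : ℤ, 0 < c ∧ 0 < d ∧ IsCoprime c d ∧ p = c * d ∧ a = c ^ 2 ∧ b = d ^ 2 := by
    intro a b ha hb hab hmul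
    have hab' : IsCoprime a b := hab.of_mul_right_right
    obtain ⟨c, hc⟩ := Int.exists_sq_of_isCoprime_of_pos hab' ha hmul
    obtain ⟨d, hd⟩ := Int.exists_sq_of_isCoprime_of_pos hab'.symm hb
      (c := p) (by rw [← hmul]; ring)
    have hc0 : c ≠ 0 := by rintro rfl; simp [hc] at ha
    have hd0 : d ≠ 0 := by rintro rfl; simp [hd] at hb
    refine ⟨|c|, |d|, abs_pos.2 hc0, abs_pos.2 hd0, ?_, ?_, by rw [sq_abs, hc], by rw [sq_abs, hd]⟩
    · rw [hc, hd] at hab'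
      exact ((IsCoprime.pow_iff two_pos two_pos).1 hab').abs_abs
    · rw [← abs_mul, ← abs_of_pos hp]
      apply (sq_eq_sq_iff_abs_eq_abs _ _).1
      rw [← hmul, hc, hd]; ring
  rcases Int.even_or_odd' n with ⟨b, rfl | rfl⟩
  · obtain ⟨c, d, hc, hd, -, rfl, hac, hbd⟩ := key (2 * b + 1) b (by omega) (by omega)
      ⟨1, -1, by ring⟩ (by linarith)
    have hcd := Int.odd_mul.1 (Int.odd_iff.2 hodd)
    have h1 := Int.sq_mod_four_eq_one_of_odd hcd.1
    have h2 := Int.sq_mod_four_eq_one_of_odd hcd.2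
    omega
  · obtain ⟨c, d, hc, hd, hcop, hpcd, hac, hbd⟩ := key (2 * b + 1) (b + 1) (by omega) (by omega)
      ⟨-1, 1, by ring⟩ (by linarith)
    exact ⟨c, d, hc, hd, hcop, hpcd, by rw [← hac, ← hbd]; ring⟩

theorem eq_zero_or_sq_eq_one_of_mul_eq {p q m : ℤ} (hp : 0 ≤ p) (hq : 0 ≤ q) (hodd : p % 2 = 1)
    (h : p ^ 2 + q ^ 2 = 6 * (p * q) + 1) (hm : p * q = 6 * m ^ 2) : m = 0 ∨ m ^ 2 = 1 := by
  have hp0 : 0 < p := by omega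
  obtain ⟨c, d, hc, hd, hcd, hpcd, h1⟩ := exists_mul_eq_of_sq_eq hp0 hodd
    (X := q - 3 * p) (by linear_combination h)
  have h3 : ¬ (3 : ℤ) ∣ p := by
    rw [hpcd, Int.prime_three.dvd_mul]
    rintro (⟨k, rfl⟩ | ⟨k, rfl⟩)
    · have : d ^ 2 % 3 = 0 ∨ d ^ 2 % 3 = 1 := by
        rcases (by omega : d % 3 = 0 ∨ d % 3 = 1 ∨ d % 3 = 2) with h | h | h <;>
          simp [pow_two, Int.mul_emod, h]
      ring_nf at h1
      omega
    · have : c ^ 2 % 3 = 0 ∨ c ^ 2 % 3 = 1 := by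
        rcases (by omega : c % 3 = 0 ∨ c % 3 = 1 ∨ c % 3 = 2) with h | h | h <;>
          simp [pow_two, Int.mul_emod, h]
      ring_nf at h1
      omega
  have hq2 : (2 : ℤ) ∣ q :=
    (Int.prime_two.dvd_or_dvd ⟨3 * m ^ 2, by rw [hm]; ring⟩).resolve_left (by omega)
  have hq3 : (3 : ℤ) ∣ q :=
    (Int.prime_three.dvd_or_dvd ⟨2 * m ^ 2, by rw [hm]; ring⟩).resolve_left h3
  obtain ⟨r, rfl⟩ : (6 : ℤ) ∣ q := by omega
  have hpr : p * r = m ^ 2 := by linarith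
  have hcop : IsCoprime p r := ⟨p, 36 * r - 36 * p, by linear_combination h⟩
  obtain ⟨s, hs⟩ := Int.exists_sq_of_isCoprime_of_pos hcop hp0 hpr
  obtain ⟨C, hC⟩ := Int.exists_sq_of_isCoprime_of_pos hcd hc (c := s) (by rw [← hpcd, hs])
  obtain ⟨D, hD⟩ := Int.exists_sq_of_isCoprime_of_pos hcd.symm hd (c := s)
    (by rw [← hs, hpcd]; ring)
  have hC1 := sq_eq_one_of_pow_four_add_one (c := C) (d := D) (by rw [hC, hD] at h1; linarith)
  have hd1 : d = 1 := by
    rw [hC, hC1] at h1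
    nlinarith
  obtain rfl : p = 1 := by rw [hpcd, hC, hC1, hd1]; rfl
  have : r * (r - 1) = 0 := by linarith
  rcases mul_eq_zero.1 this with hr | hr
  · left
    rw [hr] at hpr
    exact pow_eq_zero_iff two_ne_zero |>.1 (by linarith)
  · right
    linarith

theorem stmt_15 : ∀ x y z : ℤ, 0 ≤ x → 0 ≤ y → 0 ≤ z →
    y^2 - 3 * x^2 = 1 → z^2 - 6 * x^2 = 4 → x = 0 ∨ x = 4 := by
  intro x y z hx hy hz h1 h2
  have hze : Even z := by
    have : Even (z ^ 2) := ⟨3 * x ^ 2 + 2, by linarith⟩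
    exact (Int.even_pow.1 this).1
  obtain ⟨w, rfl⟩ := hze
  have hxe : Even x := by
    have : Even (3 * x ^ 2) := ⟨w ^ 2 - 1, by linarith⟩
    rcases Int.even_mul.1 this with h | h
    · exact absurd h (by decide)
    · exact (Int.even_pow.1 h).1
  obtain ⟨u, rfl⟩ := hxe
  have hw : w ^ 2 = 6 * u ^ 2 + 1 := by linarith
  have hy2 : y ^ 2 = 12 * u ^ 2 + 1 := by linarith
  have hwo : Odd w := by
    have : Odd (w ^ 2) := ⟨3 * u ^ 2, by rw [hw]; ring⟩
    exact (Int.odd_pow' (by norm_num)).1 this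
  have hyo : Odd y := by
    have : Odd (y ^ 2) := ⟨6 * u ^ 2, by rw [hy2]; ring⟩
    exact (Int.odd_pow' (by norm_num)).1 this
  obtain ⟨q, hq⟩ : ∃ q, y = w + 2 * q := ⟨(y - w) / 2, by
    have := Int.odd_iff.1 hwo; have := Int.odd_iff.1 hyo; omega⟩
  obtain ⟨p, rfl⟩ : ∃ p, w = p - q := ⟨w + q, by ring⟩
  obtain rfl : y = p + q := by linarith
  have hue : Even u := by
    obtain ⟨k, hk⟩ := hwo
    have h8 : 6 * u ^ 2 = 4 * (k * (k + 1)) := by rw [hk] at hw; linarith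
    obtain ⟨t, ht⟩ := Int.even_mul_succ_self k
    have : Even (u ^ 2) := by rw [Int.even_iff]; omega
    exact (Int.even_pow.1 this).1
  obtain ⟨m, rfl⟩ := hue
  have hpq : p * q = 6 * m ^ 2 := by linarith
  have hsum : p ^ 2 + q ^ 2 = 6 * (p * q) + 1 := by linarith
  have hq0 : 0 ≤ q := by nlinarith [sq_nonneg m]
  have hp0 : 0 ≤ p := by omega
  have hm : m = 0 ∨ m ^ 2 = 1 := by
    have := Int.odd_iff.1 hyo
    rcases Int.emod_two_eq_zero_or_one p with hp | hp
    · exact eq_zero_or_sq_eq_one_of_mul_eq hq0 hp0 (by omega) (by linarith) (by linarith)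
    · exact eq_zero_or_sq_eq_one_of_mul_eq hp0 hq0 hp hsum hpq
  rcases hm with hm | hm
  · left; omega
  · right
    rcases mul_self_eq_one_iff.1 (by linarith : m * m = 1) with h | h <;> omega
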